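/- arXiv:1808.04180 — 2 statements merged into one kernel-verified Lean document; each statement's English description precedes it below -/
import Mathlib

section
/- Let f : 𝒱 → W be weakly multilinear with f(𝒞) ⊆ Γ, where 𝒞 = C_1 × ⋯ × C_ν for cones C_i ⊆ V_i and Γ ⊆ W is a cone. Let Ω = {λ ∈ ℝ_+^ν : d_Γ(f(x), f(y)) ≤ Σ_{i=1}^ν λ_i · d_{C_i}(x_i, y_i) for all x, y ∈ 𝒞 with x_i ∼_{C_i} y_i for every i and f(x) ∼_Γ f(y)}. Then for every λ ∈ Ω and every i = 1, …, ν, κ_i(f) ≤ λ_i; consequently the vector (κ_1(f), …, κ_ν(f)) is the coordinatewise greatest lower bound (infimum) of Ω, and it belongs to Ω. -/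
/-- `x ⪯_C y` iff `y - x ∈ C`. -/
def coneLE {V : Type*} [AddCommGroup V] [Module ℝ V] (C : Set V) (x y : V) : Prop :=
  y - x ∈ C

/-- A (convex, pointed) cone in a real vector space. -/
def IsCone {V : Type*} [AddCommGroup V] [Module ℝ V] (C : Set V) : Prop :=
  Convex ℝ C ∧ (∀ x ∈ C, ∀ a : ℝ, 0 ≤ a → a • x ∈ C) ∧ C ∩ (-C) = {0}

/-- `x ∼_C y` : there are `α, β > 0` with `α • y ⪯_C x ⪯_C β • y`. -/
def coneComp {V : Type*} [AddCommGroup V] [Module ℝ V] (C : Set V) (x y : V) : Prop :=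
  (∃ α : ℝ, 0 < α ∧ coneLE C (α • y) x) ∧ (∃ β : ℝ, 0 < β ∧ coneLE C x (β • y))

/-- `M(x/y; C) = inf {β : x ⪯_C β • y}`. -/
noncomputable def coneM {V : Type*} [AddCommGroup V] [Module ℝ V] (C : Set V) (x y : V) : ℝ :=
  sInf {β : ℝ | coneLE C x (β • y)}

/-- The Hilbert projective metric `d_C(x,y) = log (M(x/y;C) * M(y/x;C))`. -/
noncomputable def hilbertD {V : Type*} [AddCommGroup V] [Module ℝ V] (C : Set V) (x y : V) : ℝ :=
  Real.log (coneM C x y * coneM C y x)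

/-- The projective diameter `diam(S; C)` (possibly `+∞`). -/
noncomputable def projDiam {V : Type*} [AddCommGroup V] [Module ℝ V] (C S : Set V) : EReal :=
  sSup {r : EReal | ∃ x ∈ S, ∃ y ∈ S, coneComp C x y ∧ r = ((hilbertD C x y : ℝ) : EReal)}

/-- `tanh (t/4)` with the convention `tanh ∞ = 1`. -/
noncomputable def tanh4 (t : EReal) : ℝ :=
  if t = ⊤ then 1 else Real.tanh (t.toReal / 4)

/-- A map on a finite product of vector spaces is weakly multilinear if it coincides with a
multilinear map of a subcollection of its arguments. -/
def WeaklyMultilinear {ι : Type*} [Fintype ι] [DecidableEq ι] {V : ι → Type*}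
    [∀ i, AddCommGroup (V i)] [∀ i, Module ℝ (V i)] {W : Type*} [AddCommGroup W] [Module ℝ W]
    (f : (∀ i, V i) → W) : Prop :=
  ∃ (s : Finset ι) (g : MultilinearMap ℝ (fun j : s => V j) W),
    ∀ x : ∀ i, V i, f x = g (fun j => x j)

/-- The mode-`i` Birkhoff contraction ratio
`κ_i(f) = sup_{z ∈ 𝒞} tanh (diam (f|_z^i (C_i); Γ) / 4)`. -/
noncomputable def modeKappa {ι : Type*} [Fintype ι] [DecidableEq ι] {V : ι → Type*}
    [∀ i, AddCommGroup (V i)] [∀ i, Module ℝ (V i)] {W : Type*} [AddCommGroup W] [Module ℝ W]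
    (C : ∀ i, Set (V i)) (Γ : Set W) (f : (∀ i, V i) → W) (i : ι) : ℝ :=
  sSup {r : ℝ | ∃ z : ∀ j, V j, (∀ j, z j ∈ C j) ∧
    r = tanh4 (projDiam Γ ((fun xi => f (Function.update z i xi)) '' C i))}


theorem IsCone.zmem {V : Type*} [AddCommGroup V] [Module ℝ V] {C : Set V} (hC : IsCone C) :
    (0 : V) ∈ C := by
  have h : (0 : V) ∈ C ∩ (-C) := by rw [hC.2.2]; rfl
  exact h.1

theorem IsCone.smem {V : Type*} [AddCommGroup V] [Module ℝ V] {C : Set V} (hC : IsCone C)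
    {a : ℝ} (ha : 0 ≤ a) {x : V} (hx : x ∈ C) : a • x ∈ C := hC.2.1 x hx a ha

theorem IsCone.amem {V : Type*} [AddCommGroup V] [Module ℝ V] {C : Set V} (hC : IsCone C)
    {x y : V} (hx : x ∈ C) (hy : y ∈ C) : x + y ∈ C := by
  have h : (1 / 2 : ℝ) • x + (1 / 2 : ℝ) • y ∈ C :=
    convex_iff_forall_pos.1 hC.1 hx hy (by norm_num) (by norm_num) (by norm_num)
  have h2 := hC.smem (a := 2) (by norm_num) h
  rw [smul_add, smul_smul, smul_smul] at h2
  norm_num at h2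
  exact h2

theorem IsCone.neg_mem_zero {V : Type*} [AddCommGroup V] [Module ℝ V] {C : Set V}
    (hC : IsCone C) {x : V} (hx : x ∈ C) (hy : -x ∈ C) : x = 0 := by
  have h : x ∈ C ∩ (-C) := ⟨hx, hy⟩
  rw [hC.2.2] at h
  exact h

theorem IsCone.scal_nonneg {V : Type*} [AddCommGroup V] [Module ℝ V] {C : Set V}
    (hC : IsCone C) {x : V} (hx : x ∈ C) (hx0 : x ≠ 0) {a : ℝ} (h : a • x ∈ C) : 0 ≤ a := by
  by_contra hn
  push Not at hn
  have h1 := hC.smem (a := (-a)⁻¹) (by rw [inv_nonneg]; linarith) h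
  have h2 : (-a)⁻¹ • a • x = -x := by
    rw [smul_smul]
    have : (-a)⁻¹ * a = -1 := by
      have : a ≠ 0 := hn.ne
      field_simp
    rw [this]; simp
  rw [h2] at h1
  exact hx0 (hC.neg_mem_zero hx h1)

section
variable {V : Type*} [AddCommGroup V] [Module ℝ V] {C : Set V}

theorem coneComp.rfl' (hC : IsCone C) (x : V) : coneComp C x x := by
  refine ⟨⟨1, one_pos, ?_⟩, ⟨1, one_pos, ?_⟩⟩ <;> simp [coneLE, hC.zmem]

theorem coneComp.flip (hC : IsCone C) {x y : V} (h : coneComp C x y) : coneComp C y x := by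
  obtain ⟨⟨a, ha, h1⟩, ⟨b, hb, h2⟩⟩ := h
  unfold coneLE at h1 h2
  refine ⟨⟨b⁻¹, inv_pos.2 hb, ?_⟩, ⟨a⁻¹, inv_pos.2 ha, ?_⟩⟩
  · have := hC.smem (inv_pos.2 hb).le h2
    rw [smul_sub, smul_smul, inv_mul_cancel₀ hb.ne', one_smul] at this
    exact this
  · have := hC.smem (inv_pos.2 ha).le h1
    rw [smul_sub, smul_smul, inv_mul_cancel₀ ha.ne', one_smul] at this
    exact this

theorem coneLE.comp (hC : IsCone C) {x y z : V} {a b : ℝ} (ha : 0 ≤ a)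
    (h1 : coneLE C x (a • y)) (h2 : coneLE C y (b • z)) : coneLE C x ((a * b) • z) := by
  unfold coneLE at *
  have := hC.amem h1 (hC.smem ha h2)
  have e : a • y - x + a • (b • z - y) = (a * b) • z - x := by module
  rwa [e] at this

theorem coneComp.comp (hC : IsCone C) {x y z : V} (h : coneComp C x y) (h' : coneComp C y z) :
    coneComp C x z := by
  have hs := h.flip hC
  have hs' := h'.flip hC
  obtain ⟨_, ⟨b, hb, h2⟩⟩ := h
  obtain ⟨_, ⟨b', hb', h2'⟩⟩ := h'
  obtain ⟨_, ⟨a, ha, h1⟩⟩ := hs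
  obtain ⟨_, ⟨a', ha', h1'⟩⟩ := hs'
  have : coneComp C z x := by
    refine coneComp.flip hC ⟨?_, ⟨b * b', by positivity, coneLE.comp hC hb.le h2 h2'⟩⟩
    have h3 := coneLE.comp hC ha'.le h1' h1
    refine ⟨(a' * a)⁻¹, by positivity, ?_⟩
    unfold coneLE at h3 ⊢
    have hp : 0 < a' * a := by positivity
    have := hC.smem (inv_pos.2 hp).le h3
    rwa [smul_sub, smul_smul, inv_mul_cancel₀ hp.ne', one_smul] at this
  exact this.flip hC

theorem coneComp.zero_of (hC : IsCone C) {x y : V} (hx : x ∈ C) (h : coneComp C x y)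
    (hy0 : y = 0) : x = 0 := by
  obtain ⟨_, ⟨b, hb, h2⟩⟩ := h
  subst hy0
  simp only [coneLE, smul_zero, zero_sub] at h2
  exact hC.neg_mem_zero hx h2

theorem coneM_bdd (hC : IsCone C) {x y : V} (hx : x ∈ C) (hx0 : x ≠ 0) (hy : y ∈ C) :
    ∀ β ∈ {β : ℝ | coneLE C x (β • y)}, 0 ≤ β := by
  intro β hβ
  by_contra hn
  push Not at hn
  have h1 : β • y - x ∈ C := hβ
  have h2 := hC.amem h1 (hC.smem (a := -β) (by linarith) hy)
  have e : β • y - x + (-β) • y = -x := by module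
  rw [e] at h2
  exact hx0 (hC.neg_mem_zero hx h2)

theorem coneM_le (hC : IsCone C) {x y : V} (hx : x ∈ C) (hx0 : x ≠ 0) (hy : y ∈ C) {m : ℝ}
    (h : coneLE C x (m • y)) : coneM C x y ≤ m :=
  csInf_le ⟨0, coneM_bdd hC hx hx0 hy⟩ h

theorem le_coneM {x y : V} (hc : coneComp C x y) {m : ℝ}
    (h : ∀ β, coneLE C x (β • y) → m ≤ β) : m ≤ coneM C x y := by
  obtain ⟨_, ⟨b, hb, h2⟩⟩ := hc
  exact le_csInf ⟨b, h2⟩ h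

theorem coneM_pos (hC : IsCone C) {x y : V} (hy : y ∈ C) (hy0 : y ≠ 0)
    (hc : coneComp C x y) : 0 < coneM C x y := by
  obtain ⟨a, ha, h1⟩ := hc.1
  refine lt_of_lt_of_le ha (le_coneM hc fun β hβ => ?_)
  have h2 := hC.amem h1 hβ
  have e : x - a • y + (β • y - x) = (β - a) • y := by module
  rw [e] at h2
  have := hC.scal_nonneg hy hy0 h2
  linarith

theorem coneLE_of_coneM_lt (hC : IsCone C) {x y : V} (hy : y ∈ C)
    (hc : coneComp C x y) {m : ℝ} (hm : coneM C x y < m) : coneLE C x (m • y) := by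
  obtain ⟨_, ⟨b, hb, h2⟩⟩ := hc
  obtain ⟨β, hβ, hlt⟩ := exists_lt_of_csInf_lt (s := {β : ℝ | coneLE C x (β • y)}) ⟨b, h2⟩ hm
  have h3 := hC.amem (show β • y - x ∈ C from hβ) (hC.smem (a := m - β) (by linarith) hy)
  have e : β • y - x + (m - β) • y = m • y - x := by module
  rw [e] at h3
  exact h3

theorem coneM_mul_le (hC : IsCone C) {x y z : V} (hx : x ∈ C) (hx0 : x ≠ 0) (hy : y ∈ C)
    (hy0 : y ≠ 0) (hz : z ∈ C) (hz0 : z ≠ 0) (h : coneComp C x y) (h' : coneComp C y z) :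
    coneM C x z ≤ coneM C x y * coneM C y z := by
  have p1 := coneM_pos hC hy hy0 h
  have p2 := coneM_pos hC hz hz0 h'
  have key : ∀ e : ℝ, 1 < e → coneM C x z ≤ (coneM C x y * coneM C y z) * (e * e) := by
    intro e he
    have h1 := coneLE_of_coneM_lt hC hy h (m := coneM C x y * e) (by nlinarith)
    have h2 := coneLE_of_coneM_lt hC hz h' (m := coneM C y z * e) (by nlinarith)
    have h3 := coneM_le hC hx hx0 hz (coneLE.comp hC (by positivity) h1 h2)
    linarith
  have ht : Filter.Tendsto (fun e : ℝ => (coneM C x y * coneM C y z) * (e * e))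
      (nhdsWithin 1 (Set.Ioi 1)) (nhds ((coneM C x y * coneM C y z) * (1 * 1))) := by
    apply Filter.Tendsto.mono_left _ nhdsWithin_le_nhds
    exact Continuous.tendsto (by fun_prop) 1
  rw [one_mul, mul_one] at ht
  exact ge_of_tendsto ht (by filter_upwards [self_mem_nhdsWithin] with e he using key e he)

theorem coneM_self (hC : IsCone C) {x : V} (hx : x ∈ C) (hx0 : x ≠ 0) : coneM C x x = 1 := by
  apply le_antisymm
  · exact coneM_le hC hx hx0 hx (by simp [coneLE, hC.zmem])
  · refine le_coneM (coneComp.rfl' hC x) fun β hβ => ?_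
    have e : β • x - x = (β - 1) • x := by module
    unfold coneLE at hβ
    rw [e] at hβ
    have := hC.scal_nonneg hx hx0 hβ
    linarith

theorem hilbertD_zero_zero : hilbertD C (0 : V) 0 = 0 := by
  unfold hilbertD coneM
  by_cases h : (0 : V) ∈ C
  · have : {β : ℝ | coneLE C (0 : V) (β • (0 : V))} = Set.univ := by
      ext; simp [coneLE, h]
    rw [this]; simp
  · have : {β : ℝ | coneLE C (0 : V) (β • (0 : V))} = ∅ := by
      ext; simp [coneLE, h]
    rw [this]; simp

theorem hilbertD_self (hC : IsCone C) {x : V} (hx : x ∈ C) : hilbertD C x x = 0 := by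
  by_cases hx0 : x = 0
  · subst hx0; exact hilbertD_zero_zero
  · simp [hilbertD, coneM_self hC hx hx0]

theorem one_le_coneM_mul (hC : IsCone C) {x y : V} (hx : x ∈ C) (hx0 : x ≠ 0) (hy : y ∈ C)
    (hy0 : y ≠ 0) (h : coneComp C x y) : 1 ≤ coneM C x y * coneM C y x := by
  have := coneM_mul_le hC hx hx0 hy hy0 hx hx0 h (h.flip hC)
  rwa [coneM_self hC hx hx0] at this

theorem hilbertD_nonneg (hC : IsCone C) {x y : V} (hx : x ∈ C) (hy : y ∈ C)
    (h : coneComp C x y) : 0 ≤ hilbertD C x y := by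
  by_cases hy0 : y = 0
  · have hx0 := h.zero_of hC hx hy0
    subst hx0; subst hy0; exact hilbertD_zero_zero.ge
  · have hx0 : x ≠ 0 := fun e => hy0 ((h.flip hC).zero_of hC hy e)
    exact Real.log_nonneg (one_le_coneM_mul hC hx hx0 hy hy0 h)

theorem hilbertD_tri (hC : IsCone C) {x y z : V} (hx : x ∈ C) (hy : y ∈ C) (hz : z ∈ C)
    (h : coneComp C x y) (h' : coneComp C y z) :
    hilbertD C x z ≤ hilbertD C x y + hilbertD C y z := by
  by_cases hy0 : y = 0
  · have hx0 := h.zero_of hC hx hy0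
    have hz0 := (h'.flip hC).zero_of hC hz hy0
    subst hx0; subst hy0; subst hz0; simp [hilbertD_zero_zero]
  · have hx0 : x ≠ 0 := fun e => hy0 ((h.flip hC).zero_of hC hy e)
    have hz0 : z ≠ 0 := fun e => hy0 (h'.zero_of hC hy e)
    have h1 := coneM_mul_le hC hx hx0 hy hy0 hz hz0 h h'
    have h2 := coneM_mul_le hC hz hz0 hy hy0 hx hx0 (h'.flip hC) (h.flip hC)
    have p1 := coneM_pos hC hy hy0 h
    have p2 := coneM_pos hC hz hz0 h'
    have p3 := coneM_pos hC hx hx0 (h.flip hC)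
    have p4 := coneM_pos hC hy hy0 (h'.flip hC)
    have p5 := coneM_pos hC hz hz0 (h.comp hC h')
    have p6 := coneM_pos hC hx hx0 ((h.comp hC h').flip hC)
    unfold hilbertD
    rw [← Real.log_mul (by positivity) (by positivity)]
    apply Real.log_le_log (by positivity)
    calc _ ≤ (coneM C x y * coneM C y z) * (coneM C z y * coneM C y x) := by gcongr
      _ = _ := by ring

theorem hilbertD_le_log (hC : IsCone C) {x y : V} (hx : x ∈ C) (hx0 : x ≠ 0) (hy : y ∈ C)
    (hy0 : y ≠ 0) (h : coneComp C x y) {m m' : ℝ} (h1 : coneLE C x (m • y))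
    (h2 : coneLE C y (m' • x)) : hilbertD C x y ≤ Real.log (m * m') := by
  have p1 := coneM_pos hC hy hy0 h
  have p3 := coneM_pos hC hx hx0 (h.flip hC)
  have q1 := coneM_le hC hx hx0 hy h1
  have q2 := coneM_le hC hy hy0 hx h2
  unfold hilbertD
  apply Real.log_le_log (by positivity)
  gcongr
  linarith

end

theorem tanh_mono_aux {a b : ℝ} (h : a ≤ b) : Real.tanh a ≤ Real.tanh b := by
  by_contra hn
  push Not at hn
  have := Real.artanh_lt_artanh (Real.neg_one_lt_tanh b) (Real.tanh_lt_one a) hn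
  rw [Real.artanh_tanh, Real.artanh_tanh] at this
  linarith

theorem tanh_quarter_log {p q : ℝ} (hp : 0 < p) (hq : 0 < q) :
    Real.tanh (Real.log (q ^ 2 / p ^ 2) / 4) = (q - p) / (q + p) := by
  have h : Real.log (q ^ 2 / p ^ 2) / 4 = Real.log (q / p) / 2 := by
    rw [← div_pow, Real.log_pow]; push_cast; ring
  rw [h, Real.tanh_eq]
  set t := Real.log (q / p) / 2
  have e1 : Real.exp t * Real.exp t = q / p := by
    rw [← Real.exp_add, show t + t = Real.log (q / p) by simp only [t]; ring,
      Real.exp_log (by positivity)]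
  rw [Real.exp_neg]
  have hE := Real.exp_pos t
  set E := Real.exp t
  have e2 : E * E * p = q := by rw [e1]; field_simp
  rw [← e2]
  field_simp

/-- squared parametrisation: `a = p^2`, `b = q^2`. -/
theorem real_upper {p q r : ℝ} (hp : 0 < p) (hpq : p ≤ q) (hr : 1 ≤ r) :
    Real.log (((1 + q ^ 2 * r) * (1 + p ^ 2)) / ((1 + q ^ 2) * (1 + p ^ 2 * r))) ≤
      (q - p) / (q + p) * Real.log r := by
  have hq : 0 < q := lt_of_lt_of_le hp hpq
  set g : ℝ → ℝ := fun r => (q - p) / (q + p) * Real.log r - Real.log (1 + q ^ 2 * r)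
    + Real.log (1 + p ^ 2 * r) with hg
  have hder : ∀ x : ℝ, 0 < x → HasDerivAt g
      ((q - p) / (q + p) * x⁻¹ - q ^ 2 / (1 + q ^ 2 * x) + p ^ 2 / (1 + p ^ 2 * x)) x := by
    intro x hx
    have l1 : HasDerivAt (fun r : ℝ => 1 + q ^ 2 * r) (q ^ 2) x := by
      simpa using ((hasDerivAt_id x).const_mul (q ^ 2)).const_add 1
    have l2 : HasDerivAt (fun r : ℝ => 1 + p ^ 2 * r) (p ^ 2) x := by
      simpa using ((hasDerivAt_id x).const_mul (p ^ 2)).const_add 1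
    exact (((Real.hasDerivAt_log hx.ne').const_mul _).sub (l1.log (by positivity))).add
      (l2.log (by positivity))
  have hmono : MonotoneOn g (Set.Ici 1) := by
    apply monotoneOn_of_deriv_nonneg (convex_Ici 1)
    · intro x hx
      exact (hder x (lt_of_lt_of_le one_pos hx)).continuousAt.continuousWithinAt
    · intro x hx
      rw [interior_Ici] at hx
      exact (hder x (lt_trans one_pos hx)).differentiableAt.differentiableWithinAt
    · intro x hx
      rw [interior_Ici] at hx
      have hx0 : 0 < x := lt_trans one_pos hx
      rw [(hder x hx0).deriv]
      have e : (q - p) / (q + p) * x⁻¹ - q ^ 2 / (1 + q ^ 2 * x) + p ^ 2 / (1 + p ^ 2 * x)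
          = (q - p) * (1 - p * q * x) ^ 2 /
            ((q + p) * x * (1 + q ^ 2 * x) * (1 + p ^ 2 * x)) := by
        field_simp
        ring
      rw [e]
      have : 0 ≤ q - p := by linarith
      positivity
  have h1 := hmono (Set.mem_Ici.2 le_rfl) (Set.mem_Ici.2 hr) hr
  have hr0 : 0 < r := by linarith
  simp only [hg, Real.log_one, mul_one, mul_zero] at h1
  rw [Real.log_div (by positivity) (by positivity), Real.log_mul (by positivity) (by positivity),
    Real.log_mul (by positivity) (by positivity)]
  linarith

theorem real_lower {p q l : ℝ} (hp : 0 < p) (hq : 0 < q)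
    (h : ∀ t : ℝ, p * q < t →
      Real.log ((p * q + q ^ 2) / (t + q ^ 2) * ((t + p ^ 2) / (p * q + p ^ 2)))
        ≤ l * Real.log (t / (p * q))) : (q - p) / (q + p) ≤ l := by
  set s := p * q with hs
  have hs0 : 0 < s := by positivity
  set g : ℝ → ℝ := fun t => l * (Real.log t - Real.log s) - (Real.log (s + q ^ 2)
    - Real.log (t + q ^ 2) + (Real.log (t + p ^ 2) - Real.log (s + p ^ 2))) with hg
  have hder : HasDerivAt g (l * s⁻¹ - (0 - 1 / (s + q ^ 2) + 1 / (s + p ^ 2))) s := by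
    have l1 : HasDerivAt (fun t : ℝ => t + q ^ 2) 1 s := (hasDerivAt_id s).add_const _
    have l2 : HasDerivAt (fun t : ℝ => t + p ^ 2) 1 s := (hasDerivAt_id s).add_const _
    exact (((Real.hasDerivAt_log hs0.ne').sub_const _).const_mul l).sub
      (((hasDerivAt_const s _).sub (l1.log (by positivity))).add
        ((l2.log (by positivity)).sub_const _))
  have ht := hder.tendsto_slope_zero_right
  have hnn : 0 ≤ l * s⁻¹ - (0 - 1 / (s + q ^ 2) + 1 / (s + p ^ 2)) := by
    refine ge_of_tendsto ht ?_
    filter_upwards [self_mem_nhdsWithin] with e he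
    have he : 0 < e := he
    have h1 := h (s + e) (by linarith)
    have g0 : g s = 0 := by simp [hg]
    have g1 : 0 ≤ g (s + e) := by
      rw [Real.log_mul (by positivity) (by positivity), Real.log_div (by positivity) (by positivity),
        Real.log_div (by positivity) (by positivity),
        Real.log_div (by positivity) (by positivity)] at h1
      simp only [hg]
      linarith
    rw [g0, sub_zero]
    exact smul_nonneg (inv_nonneg.2 he.le) g1
  have e : l * s⁻¹ - (0 - 1 / (s + q ^ 2) + 1 / (s + p ^ 2)) = (l - (q - p) / (q + p)) / s := by
    rw [hs]
    field_simp
    ring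
  rw [e] at hnn
  have := nonneg_of_mul_nonneg_left (by rwa [div_eq_mul_inv] at hnn) (inv_pos.2 hs0)
  linarith

section
variable {W : Type*} [AddCommGroup W] [Module ℝ W] {Γ S : Set W}

theorem tanh4_ge {x y : W} (hx : x ∈ S) (hy : y ∈ S) (h : coneComp Γ x y) :
    Real.tanh (hilbertD Γ x y / 4) ≤ tanh4 (projDiam Γ S) := by
  have hle : ((hilbertD Γ x y : ℝ) : EReal) ≤ projDiam Γ S :=
    le_sSup ⟨x, hx, y, hy, h, rfl⟩
  unfold tanh4
  split_ifs with ht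
  · exact (Real.tanh_lt_one _).le
  · apply tanh_mono_aux
    have hb : projDiam Γ S ≠ ⊥ := fun e => by
      rw [e] at hle; exact EReal.coe_ne_bot _ (le_bot_iff.1 hle)
    have := EReal.toReal_le_toReal hle (EReal.coe_ne_bot _) ht
    rw [EReal.toReal_coe] at this
    linarith

theorem tanh4_nonneg (hΓ : IsCone Γ) (hS : S ⊆ Γ) (hne : S.Nonempty) :
    0 ≤ tanh4 (projDiam Γ S) := by
  obtain ⟨x, hx⟩ := hne
  have := tanh4_ge (Γ := Γ) hx hx (coneComp.rfl' hΓ x)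
  rw [hilbertD_self hΓ (hS hx)] at this
  simpa using this

theorem tanh4_le_one (t : EReal) : tanh4 t ≤ 1 := by
  unfold tanh4
  split_ifs with ht
  · exact le_rfl
  · exact (Real.tanh_lt_one _).le

theorem tanh4_le {l : ℝ} (hΓ : IsCone Γ) (hS : S ⊆ Γ) (hne : S.Nonempty) (hl : 0 ≤ l)
    (h : ∀ x ∈ S, ∀ y ∈ S, coneComp Γ x y → Real.tanh (hilbertD Γ x y / 4) ≤ l) :
    tanh4 (projDiam Γ S) ≤ l := by
  by_cases hl1 : 1 ≤ l
  · exact (tanh4_le_one _).trans hl1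
  push Not at hl1
  have hle : projDiam Γ S ≤ ((4 * Real.artanh l : ℝ) : EReal) := by
    apply sSup_le
    rintro r ⟨x, hx, y, hy, hc, rfl⟩
    have h1 := Real.artanh_le_artanh (Real.neg_one_lt_tanh _) hl1 (h x hx y hy hc)
    rw [Real.artanh_tanh] at h1
    rw [EReal.coe_le_coe_iff]
    linarith
  have ht : projDiam Γ S ≠ ⊤ := fun e => by
    rw [e] at hle; exact EReal.coe_ne_top _ (top_le_iff.1 hle)
  have hb : projDiam Γ S ≠ ⊥ := by
    obtain ⟨x, hx⟩ := hne
    intro e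
    have : ((hilbertD Γ x x : ℝ) : EReal) ≤ projDiam Γ S :=
      le_sSup ⟨x, hx, x, hx, coneComp.rfl' hΓ x, rfl⟩
    rw [e] at this; exact EReal.coe_ne_bot _ (le_bot_iff.1 this)
  unfold tanh4
  rw [if_neg ht]
  have h2 := EReal.toReal_le_toReal hle hb (EReal.coe_ne_top _)
  rw [EReal.toReal_coe] at h2
  calc _ ≤ Real.tanh (Real.artanh l) := tanh_mono_aux (by linarith)
    _ = l := Real.tanh_artanh ⟨by linarith, hl1⟩

end

theorem continuous_tanh_aux : Continuous Real.tanh := by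
  have : Real.tanh = fun x => Real.sinh x / Real.cosh x := by
    funext x; exact Real.tanh_eq_sinh_div_cosh x
  rw [this]
  exact Real.continuous_sinh.div Real.continuous_cosh fun x => (Real.cosh_pos x).ne'

theorem coneComp.map {V W : Type*} [AddCommGroup V] [Module ℝ V] [AddCommGroup W] [Module ℝ W]
    {C : Set V} {Γ : Set W} (L : V →ₗ[ℝ] W) (hL : ∀ x ∈ C, L x ∈ Γ) {x y : V}
    (h : coneComp C x y) : coneComp Γ (L x) (L y) := by
  obtain ⟨⟨a, ha, h1⟩, ⟨b, hb, h2⟩⟩ := h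
  refine ⟨⟨a, ha, ?_⟩, ⟨b, hb, ?_⟩⟩
  · have := hL _ h1
    rwa [map_sub, map_smul] at this
  · have := hL _ h2
    rwa [map_sub, map_smul] at this

theorem two_dim {W : Type*} [AddCommGroup W] [Module ℝ W] {Γ : Set W} (hΓ : IsCone Γ)
    {X Y P Q : W} (hX : X ∈ Γ) (hX0 : X ≠ 0) (hY : Y ∈ Γ) (hY0 : Y ≠ 0)
    (hP : P ∈ Γ) (hP0 : P ≠ 0) (hQ : Q ∈ Γ) (hQ0 : Q ≠ 0)
    (hXY : coneComp Γ X Y) (hPQ : coneComp Γ P Q) {α β : ℝ} (hα : 0 < α) (hαβ : α ≤ β)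
    (eP : P = X - α • Y) (eQ : Q = β • Y - X) :
    hilbertD Γ X Y ≤ Real.tanh (hilbertD Γ P Q / 4) * Real.log (β / α) := by
  have p1 := coneM_pos hΓ hQ hQ0 hPQ
  have p2 := coneM_pos hΓ hP hP0 (hPQ.flip hΓ)
  have p3 := one_le_coneM_mul hΓ hP hP0 hQ hQ0 hPQ
  have hβ : 0 < β := lt_of_lt_of_le hα hαβ
  have key : ∀ e : ℝ, 1 < e → hilbertD Γ X Y ≤
      Real.tanh (Real.log ((coneM Γ P Q * coneM Γ Q P) * (e * e)) / 4) * Real.log (β / α) := by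
    intro e he
    have he0 : 0 < e := by linarith
    obtain ⟨b, hb⟩ : ∃ b, b = coneM Γ P Q * e := ⟨_, rfl⟩
    obtain ⟨m, hm⟩ : ∃ m, m = coneM Γ Q P * e := ⟨_, rfl⟩
    have hb0 : 0 < b := by rw [hb]; positivity
    have hm0 : 0 < m := by rw [hm]; positivity
    have h1 : coneLE Γ P (b • Q) := coneLE_of_coneM_lt hΓ hQ hPQ (by rw [hb]; nlinarith)
    have h2 : coneLE Γ Q (m • P) :=
      coneLE_of_coneM_lt hΓ hP (hPQ.flip hΓ) (by rw [hm]; nlinarith)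
    unfold coneLE at h1 h2
    have g1 : coneLE Γ X (((α + b * β) / (1 + b)) • Y) := by
      have := hΓ.smem (a := (1 + b)⁻¹) (by positivity) h1
      have ee : (1 + b)⁻¹ • (b • Q - P) = ((α + b * β) / (1 + b)) • Y - X := by
        rw [eP, eQ]
        match_scalars <;> field_simp <;> ring
      rwa [ee] at this
    have g2 : coneLE Γ Y (((1 + m⁻¹) / (α + m⁻¹ * β)) • X) := by
      have := hΓ.smem (a := (α * m + β)⁻¹) (by positivity) h2
      have ee : (α * m + β)⁻¹ • (m • P - Q) = ((1 + m⁻¹) / (α + m⁻¹ * β)) • X - Y := by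
        rw [eP, eQ]
        match_scalars <;> field_simp <;> ring
      rwa [ee] at this
    have g3 := hilbertD_le_log hΓ hX hX0 hY hY0 hXY g1 g2
    have hbm : 1 ≤ b * m := by
      rw [hb, hm]
      have : 1 ≤ e * e := by nlinarith
      nlinarith
    have hab : m⁻¹ ≤ b := by
      rw [inv_le_iff_one_le_mul₀ hm0]; exact hbm
    have hsp : 0 < √(m⁻¹) := Real.sqrt_pos.2 (by positivity)
    have hsq : 0 < √b := Real.sqrt_pos.2 hb0
    have g4 := real_upper hsp (Real.sqrt_le_sqrt hab) (r := β / α) (by rwa [one_le_div hα])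
    rw [← tanh_quarter_log hsp hsq, Real.sq_sqrt (inv_pos.2 hm0).le, Real.sq_sqrt hb0.le] at g4
    have e1 : (1 + b * (β / α)) * (1 + m⁻¹) / ((1 + b) * (1 + m⁻¹ * (β / α))) =
        (α + b * β) / (1 + b) * ((1 + m⁻¹) / (α + m⁻¹ * β)) := by
      field_simp
    have e2 : b / m⁻¹ = (coneM Γ P Q * coneM Γ Q P) * (e * e) := by
      rw [hb, hm]; field_simp
    rw [e1, e2] at g4
    exact g3.trans g4
  have ht : Filter.Tendsto (fun e : ℝ =>
      Real.tanh (Real.log ((coneM Γ P Q * coneM Γ Q P) * (e * e)) / 4) * Real.log (β / α))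
      (nhdsWithin 1 (Set.Ioi 1))
      (nhds (Real.tanh (Real.log ((coneM Γ P Q * coneM Γ Q P) * (1 * 1)) / 4) *
        Real.log (β / α))) := by
    apply Filter.Tendsto.mono_left _ nhdsWithin_le_nhds
    refine Filter.Tendsto.mul_const _ ?_
    refine (continuous_tanh_aux.tendsto _).comp ?_
    refine Filter.Tendsto.div_const ?_ _
    have hc : ContinuousAt (fun e : ℝ => Real.log ((coneM Γ P Q * coneM Γ Q P) * (e * e))) 1 := by
      apply ContinuousAt.log
      · fun_prop
      · positivity
    exact hc
  rw [one_mul, mul_one] at ht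
  exact ge_of_tendsto ht (by filter_upwards [self_mem_nhdsWithin] with e he using key e he)

section
variable {V W : Type*} [AddCommGroup V] [Module ℝ V] [AddCommGroup W] [Module ℝ W]
    {C : Set V} {Γ : Set W}

theorem bh_upper (hC : IsCone C) (hΓ : IsCone Γ) (L : V →ₗ[ℝ] W) (hL : ∀ x ∈ C, L x ∈ Γ)
    {K : ℝ} (hK0 : 0 ≤ K)
    (hK : ∀ p ∈ C, ∀ q ∈ C, coneComp Γ (L p) (L q) → Real.tanh (hilbertD Γ (L p) (L q) / 4) ≤ K)
    {x y : V} (hx : x ∈ C) (hy : y ∈ C) (h : coneComp C x y) :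
    hilbertD Γ (L x) (L y) ≤ K * hilbertD C x y := by
  have hc := h.map L hL
  by_cases hLy : L y = 0
  · have hLx := hc.zero_of hΓ (hL x hx) hLy
    rw [hLx, hLy, hilbertD_zero_zero]
    exact mul_nonneg hK0 (hilbertD_nonneg hC hx hy h)
  have hLx : L x ≠ 0 := fun e => hLy ((hc.flip hΓ).zero_of hΓ (hL y hy) e)
  have hy0 : y ≠ 0 := fun e => hLy (by rw [e, map_zero])
  have hx0 : x ≠ 0 := fun e => hLx (by rw [e, map_zero])
  have p1 := coneM_pos hC hy hy0 h
  have p2 := coneM_pos hC hx hx0 (h.flip hC)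
  have p3 := one_le_coneM_mul hC hx hx0 hy hy0 h
  have key : ∀ e : ℝ, 1 < e → hilbertD Γ (L x) (L y) ≤
      K * Real.log ((coneM C x y * coneM C y x) * ((e * e) * (e * e))) := by
    intro e he
    have he0 : 0 < e := by linarith
    obtain ⟨b, hb⟩ : ∃ b, b = coneM C x y * e := ⟨_, rfl⟩
    obtain ⟨m, hm⟩ : ∃ m, m = coneM C y x * e := ⟨_, rfl⟩
    have hb0 : 0 < b := by rw [hb]; positivity
    have hm0 : 0 < m := by rw [hm]; positivity
    have h1 : b • y - x ∈ C := coneLE_of_coneM_lt hC hy h (by rw [hb]; nlinarith)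
    have h2 : m • x - y ∈ C := coneLE_of_coneM_lt hC hx (h.flip hC) (by rw [hm]; nlinarith)
    have hbm : 1 ≤ b * m := by
      rw [hb, hm]
      have : 1 ≤ e * e := by nlinarith
      nlinarith
    obtain ⟨p, hp⟩ : ∃ p, p = x - (m * e)⁻¹ • y := ⟨_, rfl⟩
    obtain ⟨q, hq⟩ : ∃ q, q = (b * e) • y - x := ⟨_, rfl⟩
    have hd1 : 0 < m⁻¹ - (m * e)⁻¹ := by
      rw [mul_inv]
      have : e⁻¹ < 1 := inv_lt_one_of_one_lt₀ he
      have : 0 < m⁻¹ := by positivity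
      nlinarith
    have hd2 : 0 < b * e - b := by nlinarith
    have hpl : p - (m⁻¹ - (m * e)⁻¹) • y ∈ C := by
      have := hC.smem (a := m⁻¹) (by positivity) h2
      have ee : m⁻¹ • (m • x - y) = p - (m⁻¹ - (m * e)⁻¹) • y := by
        rw [hp]
        match_scalars <;> field_simp <;> ring
      rwa [ee] at this
    have hql : q - (b * e - b) • y ∈ C := by
      have ee : b • y - x = q - (b * e - b) • y := by
        rw [hq]; module
      rwa [ee] at h1
    have hpC : p ∈ C := by
      have := hC.amem hpl (hC.smem hd1.le hy)
      rwa [sub_add_cancel] at this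
    have hqC : q ∈ C := by
      have := hC.amem hql (hC.smem hd2.le hy)
      rwa [sub_add_cancel] at this
    have cp : coneComp C p y := by
      refine ⟨⟨_, hd1, hpl⟩, ⟨b, hb0, ?_⟩⟩
      have := hC.amem h1 (hC.smem (a := (m * e)⁻¹) (by positivity) hy)
      have ee : b • y - x + (m * e)⁻¹ • y = b • y - p := by rw [hp]; module
      rwa [ee] at this
    have cq : coneComp C q y := by
      refine ⟨⟨_, hd2, hql⟩, ⟨b * e, by positivity, ?_⟩⟩
      have ee : (b * e) • y - q = x := by rw [hq]; module
      unfold coneLE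
      rwa [ee]
    have cpq := (cp.comp hC (cq.flip hC)).map L hL
    have hLp : L p ≠ 0 := fun e =>
      hLy (((cp.map L hL).flip hΓ).zero_of hΓ (hL y hy) e)
    have hLq : L q ≠ 0 := fun e =>
      hLy (((cq.map L hL).flip hΓ).zero_of hΓ (hL y hy) e)
    have hr : 1 ≤ (b * e) * (m * e) := by
      have : 1 ≤ e * e := by nlinarith
      nlinarith
    have T := two_dim hΓ (hL x hx) hLx (hL y hy) hLy (hL p hpC) hLp (hL q hqC) hLq hc cpq
      (α := (m * e)⁻¹) (β := b * e) (by positivity)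
      (by rw [inv_le_iff_one_le_mul₀ (by positivity)]; exact hr)
      (by rw [hp, map_sub, map_smul]) (by rw [hq, map_sub, map_smul])
    have e2 : b * e / (m * e)⁻¹ = (coneM C x y * coneM C y x) * ((e * e) * (e * e)) := by
      rw [hb, hm]; field_simp
    have hlog : 0 ≤ Real.log (b * e / (m * e)⁻¹) := by
      apply Real.log_nonneg
      rw [div_inv_eq_mul]; exact hr
    rw [← e2]
    exact T.trans (mul_le_mul_of_nonneg_right (hK p hpC q hqC cpq) hlog)
  have ht : Filter.Tendsto (fun e : ℝ =>
      K * Real.log ((coneM C x y * coneM C y x) * ((e * e) * (e * e))))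
      (nhdsWithin 1 (Set.Ioi 1))
      (nhds (K * Real.log ((coneM C x y * coneM C y x) * ((1 * 1) * (1 * 1))))) := by
    apply Filter.Tendsto.mono_left _ nhdsWithin_le_nhds
    refine Filter.Tendsto.const_mul _ ?_
    have hc : ContinuousAt
        (fun e : ℝ => Real.log ((coneM C x y * coneM C y x) * ((e * e) * (e * e)))) 1 := by
      apply ContinuousAt.log
      · fun_prop
      · positivity
    exact hc
  rw [one_mul, one_mul, mul_one] at ht
  exact ge_of_tendsto ht (by filter_upwards [self_mem_nhdsWithin] with e he using key e he)

theorem bh_lower (hC : IsCone C) (hΓ : IsCone Γ) (L : V →ₗ[ℝ] W) (hL : ∀ x ∈ C, L x ∈ Γ)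
    {l : ℝ} (hl : 0 ≤ l)
    (h : ∀ x ∈ C, ∀ y ∈ C, coneComp C x y → hilbertD Γ (L x) (L y) ≤ l * hilbertD C x y)
    {x y : V} (hx : x ∈ C) (hy : y ∈ C) (hc : coneComp Γ (L x) (L y)) :
    Real.tanh (hilbertD Γ (L x) (L y) / 4) ≤ l := by
  by_cases hLy : L y = 0
  · have hLx := hc.zero_of hΓ (hL x hx) hLy
    rw [hLx, hLy, hilbertD_zero_zero]
    simpa using hl
  have hLx : L x ≠ 0 := fun e => hLy ((hc.flip hΓ).zero_of hΓ (hL y hy) e)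
  obtain ⟨X, hX⟩ : ∃ X, X = L x := ⟨_, rfl⟩
  obtain ⟨Y, hY⟩ : ∃ Y, Y = L y := ⟨_, rfl⟩
  have XΓ : X ∈ Γ := hX ▸ hL x hx
  have YΓ : Y ∈ Γ := hY ▸ hL y hy
  rw [← hX, ← hY] at hc
  rw [← hX] at hLx
  rw [← hY] at hLy
  rw [← hX, ← hY]
  have p1 := coneM_pos hΓ YΓ hLy hc
  have p2 := coneM_pos hΓ XΓ hLx (hc.flip hΓ)
  have hq : 0 < √(coneM Γ X Y) := Real.sqrt_pos.2 p1
  have hp : 0 < √((coneM Γ Y X)⁻¹) := Real.sqrt_pos.2 (by positivity)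
  have eD : hilbertD Γ X Y =
      Real.log (√(coneM Γ X Y) ^ 2 / √((coneM Γ Y X)⁻¹) ^ 2) := by
    rw [Real.sq_sqrt p1.le, Real.sq_sqrt (by positivity), div_inv_eq_mul]; rfl
  rw [eD, tanh_quarter_log hp hq]
  apply real_lower hp hq
  rw [Real.sq_sqrt p1.le, Real.sq_sqrt (by positivity)]
  have hs0 := mul_pos hp hq
  obtain ⟨s, hs⟩ : ∃ s, s = √((coneM Γ Y X)⁻¹) * √(coneM Γ X Y) := ⟨_, rfl⟩
  rw [← hs] at hs0 ⊢
  obtain ⟨b, hb⟩ : ∃ b, b = coneM Γ X Y := ⟨_, rfl⟩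
  obtain ⟨a, ha⟩ : ∃ a, a = (coneM Γ Y X)⁻¹ := ⟨_, rfl⟩
  have hb0 : 0 < b := hb ▸ p1
  have ha0 : 0 < a := by rw [ha]; positivity
  rw [← hb, ← ha]
  intro t hst
  have ht0 : 0 < t := by linarith
  have huC : x + s • y ∈ C := hC.amem hx (hC.smem hs0.le hy)
  have hvC : x + t • y ∈ C := hC.amem hx (hC.smem ht0.le hy)
  have eu : L (x + s • y) = X + s • Y := by rw [map_add, map_smul, hX, hY]
  have ev : L (x + t • y) = X + t • Y := by rw [map_add, map_smul, hX, hY]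
  have uv1 : coneLE C (x + s • y) ((1 : ℝ) • (x + t • y)) := by
    have := hC.smem (a := t - s) (by linarith) hy
    have ee : (t - s) • y = (1 : ℝ) • (x + t • y) - (x + s • y) := by module
    rwa [ee] at this
  have uv2 : coneLE C (x + t • y) ((t / s) • (x + s • y)) := by
    have h1 : 0 ≤ t / s - 1 := by
      rw [sub_nonneg, one_le_div hs0]; exact hst.le
    have := hC.smem h1 hx
    have ee : (t / s - 1) • x = (t / s) • (x + s • y) - (x + t • y) := by
      match_scalars <;> field_simp <;> ring
    rwa [ee] at this
  have cuv : coneComp C (x + s • y) (x + t • y) := by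
    refine ⟨⟨s / t, by positivity, ?_⟩, ⟨1, one_pos, uv1⟩⟩
    have := hC.smem (a := s / t) (by positivity) uv2
    have ee : (s / t) • ((t / s) • (x + s • y) - (x + t • y)) =
        (x + s • y) - (s / t) • (x + t • y) := by
      match_scalars <;> field_simp
    rwa [ee] at this
  have cUV := cuv.map L hL
  have hpos : ∀ r : ℝ, 0 < r → X + r • Y ≠ 0 := by
    intro r hr e
    have : X = -(r • Y) := eq_neg_of_add_eq_zero_left e
    exact hLx (hΓ.neg_mem_zero XΓ (by rw [this, neg_neg]; exact hΓ.smem hr.le YΓ))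
  have hU0 := hpos s hs0
  have hV0 := hpos t ht0
  have hu0 : x + s • y ≠ 0 := fun e => hU0 (by rw [← eu, e, map_zero])
  have hv0 : x + t • y ≠ 0 := fun e => hV0 (by rw [← ev, e, map_zero])
  have d1 := hilbertD_le_log hC huC hu0 hvC hv0 cuv uv1 uv2
  rw [one_mul] at d1
  have d2 := h _ huC _ hvC cuv
  rw [eu, ev] at d2 cUV
  refine le_trans ?_ (d2.trans (mul_le_mul_of_nonneg_left d1 hl))
  have m1 : (s + b) / (t + b) ≤ coneM Γ (X + s • Y) (X + t • Y) := by
    refine le_coneM cUV fun β hβ => ?_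
    rw [div_le_iff₀ (by positivity)]
    unfold coneLE at hβ
    by_cases h1 : 1 ≤ β
    · nlinarith
    · push Not at h1
      have h1' : 0 < 1 - β := by linarith
      have hm := hΓ.smem (inv_pos.2 h1').le hβ
      have ee : (1 - β)⁻¹ • (β • (X + t • Y) - (X + s • Y)) =
          ((β * t - s) / (1 - β)) • Y - X := by
        match_scalars <;> field_simp <;> ring
      rw [ee] at hm
      have := coneM_le hΓ XΓ hLx YΓ hm
      rw [← hb, le_div_iff₀ h1'] at this
      linarith
  have m2 : (t + a) / (s + a) ≤ coneM Γ (X + t • Y) (X + s • Y) := by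
    refine le_coneM (cUV.flip hΓ) fun β hβ => ?_
    rw [div_le_iff₀ (by positivity)]
    unfold coneLE at hβ
    by_cases h2 : t ≤ β * s
    · have : 1 ≤ β := by
        by_contra hn
        push Not at hn
        nlinarith
      nlinarith
    · push Not at h2
      have h2' : 0 < t - β * s := by linarith
      have hm := hΓ.smem (inv_pos.2 h2').le hβ
      have ee : (t - β * s)⁻¹ • (β • (X + s • Y) - (X + t • Y)) =
          ((β - 1) / (t - β * s)) • X - Y := by
        match_scalars <;> field_simp <;> ring
      rw [ee] at hm
      have := coneM_le hΓ YΓ hLy XΓ hm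
      have ha' : coneM Γ Y X = a⁻¹ := by rw [ha, inv_inv]
      rw [ha', le_div_iff₀ h2', inv_mul_le_iff₀ ha0] at this
      linarith
  unfold hilbertD
  apply Real.log_le_log (by positivity)
  exact mul_le_mul m1 m2 (by positivity) (le_trans (by positivity) m1)

end

section
variable {ι : Type*} [Fintype ι] [DecidableEq ι] {V : ι → Type*}
    [∀ i, AddCommGroup (V i)] [∀ i, Module ℝ (V i)] {W : Type*} [AddCommGroup W] [Module ℝ W]

theorem wm_cases {f : (∀ i, V i) → W} (hwm : WeaklyMultilinear f) (z : ∀ i, V i) (i : ι) :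
    (∃ L : V i →ₗ[ℝ] W, ∀ a, f (Function.update z i a) = L a) ∨
      (∀ a, f (Function.update z i a) = f z) := by
  obtain ⟨s, g, hg⟩ := hwm
  by_cases hi : i ∈ s
  · left
    refine ⟨g.toLinearMap (fun j => z j) ⟨i, hi⟩, fun a => ?_⟩
    rw [hg, MultilinearMap.toLinearMap_apply]
    congr 1
    funext j
    by_cases hj : j = ⟨i, hi⟩
    · subst hj; simp
    · rw [Function.update_of_ne hj, Function.update_of_ne]
      intro e
      exact hj (Subtype.ext e)
  · right
    intro a
    rw [hg, hg]
    congr 1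
    funext j
    rw [Function.update_of_ne]
    rintro e
    exact hi (e ▸ j.2)

theorem update_mem {C : ∀ i, Set (V i)} {z : ∀ i, V i} (hz : ∀ i, z i ∈ C i) {i : ι} {a : V i}
    (ha : a ∈ C i) : ∀ j, Function.update z i a j ∈ C j := by
  intro j
  by_cases hj : j = i
  · subst hj; simpa using ha
  · rw [Function.update_of_ne hj]; exact hz j

end

/-- **Multilinear Birkhoff–Hopf theorem (optimality)**: the vector of mode-`i` Birkhoff
contraction ratios is the coordinatewise infimum of the set `Ω` of admissible Lipschitz vectors,
and it belongs to `Ω`. -/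
theorem multilinear_birkhoff_hopf_infimum
    {ι : Type*} [Fintype ι] [DecidableEq ι] {V : ι → Type*}
    [∀ i, AddCommGroup (V i)] [∀ i, Module ℝ (V i)] {W : Type*} [AddCommGroup W] [Module ℝ W]
    (C : ∀ i, Set (V i)) (Γ : Set W) (hC : ∀ i, IsCone (C i)) (hΓ : IsCone Γ)
    (f : (∀ i, V i) → W) (hwm : WeaklyMultilinear f)
    (hf : ∀ x : ∀ i, V i, (∀ i, x i ∈ C i) → f x ∈ Γ) :
    (∀ l : ι → ℝ,
      ((∀ i, 0 ≤ l i) ∧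
        ∀ x y : ∀ i, V i, (∀ i, x i ∈ C i) → (∀ i, y i ∈ C i) →
          (∀ i, coneComp (C i) (x i) (y i)) → coneComp Γ (f x) (f y) →
          hilbertD Γ (f x) (f y) ≤ ∑ i, l i * hilbertD (C i) (x i) (y i)) →
      ∀ i, modeKappa C Γ f i ≤ l i) ∧
    ((∀ i, 0 ≤ modeKappa C Γ f i) ∧
      ∀ x y : ∀ i, V i, (∀ i, x i ∈ C i) → (∀ i, y i ∈ C i) →
        (∀ i, coneComp (C i) (x i) (y i)) → coneComp Γ (f x) (f y) →
        hilbertD Γ (f x) (f y) ≤ ∑ i, modeKappa C Γ f i * hilbertD (C i) (x i) (y i)) := by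
  have hsub : ∀ z : ∀ i, V i, (∀ i, z i ∈ C i) → ∀ i,
      ((fun xi => f (Function.update z i xi)) '' C i) ⊆ Γ := by
    rintro z hz i _ ⟨a, ha, rfl⟩
    exact hf _ (update_mem hz ha)
  have hne : ∀ z : ∀ i, V i, ∀ i,
      ((fun xi => f (Function.update z i xi)) '' C i).Nonempty := by
    intro z i
    exact ⟨_, 0, (hC i).zmem, rfl⟩
  have hle : ∀ z : ∀ i, V i, (∀ i, z i ∈ C i) → ∀ i,
      tanh4 (projDiam Γ ((fun xi => f (Function.update z i xi)) '' C i)) ≤ modeKappa C Γ f i := by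
    intro z hz i
    refine le_csSup ⟨1, ?_⟩ ⟨z, hz, rfl⟩
    rintro r ⟨_, _, rfl⟩
    exact tanh4_le_one _
  have hz0 : ∀ i, (0 : V i) ∈ C i := fun i => (hC i).zmem
  have hk0 : ∀ i, 0 ≤ modeKappa C Γ f i := fun i =>
    (tanh4_nonneg hΓ (hsub 0 hz0 i) (hne 0 i)).trans (hle 0 hz0 i)
  refine ⟨?_, hk0, ?_⟩
  · rintro l ⟨hl, h⟩ i
    refine csSup_le ⟨_, 0, hz0, rfl⟩ ?_
    rintro r ⟨z, hz, rfl⟩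
    refine tanh4_le hΓ (hsub z hz i) (hne z i) (hl i) ?_
    rcases wm_cases hwm z i with ⟨L, hL⟩ | hcst
    · have hLΓ : ∀ a ∈ C i, L a ∈ Γ := fun a ha => by
        rw [← hL]; exact hf _ (update_mem hz ha)
      rintro _ ⟨a, ha, rfl⟩ _ ⟨b, hb, rfl⟩ hc
      simp only [hL] at hc ⊢
      refine bh_lower (hC i) hΓ L hLΓ (hl i) ?_ ha hb hc
      intro x hx y hy hxy
      have hcj : ∀ j, coneComp (C j) (Function.update z i x j) (Function.update z i y j) := by
        intro j
        by_cases hj : j = i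
        · subst hj; simpa using hxy
        · rw [Function.update_of_ne hj, Function.update_of_ne hj]
          exact coneComp.rfl' (hC j) _
      have h1 := h _ _ (update_mem hz hx) (update_mem hz hy) hcj
        (by rw [hL, hL]; exact hxy.map L hLΓ)
      rw [hL, hL, Finset.sum_eq_single i] at h1
      · simpa using h1
      · intro j _ hj
        rw [Function.update_of_ne hj, Function.update_of_ne hj, hilbertD_self (hC j) (hz j),
          mul_zero]
      · simp
    · rintro _ ⟨a, ha, rfl⟩ _ ⟨b, hb, rfl⟩ hc
      simp only [hcst]
      rw [hilbertD_self hΓ (hf z hz)]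
      simpa using hl i
  · intro x y hx hy hxy _
    have step : ∀ z : ∀ i, V i, (∀ i, z i ∈ C i) → ∀ i, z i = x i →
        coneComp Γ (f z) (f (Function.update z i (y i))) ∧
        hilbertD Γ (f z) (f (Function.update z i (y i))) ≤
          modeKappa C Γ f i * hilbertD (C i) (x i) (y i) := by
      intro z hz i hi
      rcases wm_cases hwm z i with ⟨L, hL⟩ | hcst
      · have hLΓ : ∀ a ∈ C i, L a ∈ Γ := fun a ha => by
          rw [← hL]; exact hf _ (update_mem hz ha)
        have hfz : f z = L (x i) := by rw [← hL, ← hi, Function.update_eq_self]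
        rw [hfz, hL]
        refine ⟨(hxy i).map L hLΓ, bh_upper (hC i) hΓ L hLΓ (hk0 i) ?_ (hx i) (hy i) (hxy i)⟩
        intro p hp q hq hpq
        refine (tanh4_ge (S := (fun xi => f (Function.update z i xi)) '' C i)
          ⟨p, hp, ?_⟩ ⟨q, hq, ?_⟩ hpq).trans (hle z hz i)
        · exact hL p
        · exact hL q
      · rw [hcst, hilbertD_self hΓ (hf z hz)]
        exact ⟨coneComp.rfl' hΓ _,
          mul_nonneg (hk0 i) (hilbertD_nonneg (hC i) (hx i) (hy i) (hxy i))⟩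
    have main : ∀ T : Finset ι, (∀ i, T.piecewise y x i ∈ C i) ∧
        coneComp Γ (f x) (f (T.piecewise y x)) ∧
        hilbertD Γ (f x) (f (T.piecewise y x)) ≤
          ∑ i ∈ T, modeKappa C Γ f i * hilbertD (C i) (x i) (y i) := by
      intro T
      induction T using Finset.induction_on with
      | empty =>
        simp only [Finset.piecewise_empty, Finset.sum_empty]
        exact ⟨hx, coneComp.rfl' hΓ _, (hilbertD_self hΓ (hf x hx)).le⟩
      | insert i T hi ih =>
        obtain ⟨h1, h2, h3⟩ := ih
        obtain ⟨s1, s2⟩ := step _ h1 i (Finset.piecewise_eq_of_notMem _ _ _ hi)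
        rw [Finset.piecewise_insert, Finset.sum_insert hi]
        have hm := update_mem h1 (hy i)
        refine ⟨hm, h2.comp hΓ s1, ?_⟩
        have := hilbertD_tri hΓ (hf _ hx) (hf _ h1) (hf _ hm) h2 s1
        linarith
    have := (main Finset.univ).2.2
    rwa [Finset.piecewise_univ] at this
end

section
/- Let C_1, …, C_ν be cones in real vector spaces and 𝒞 = C_1 × ⋯ × C_ν. Let f : 𝒞 → 𝒞 be order-preserving (x ⪯_𝒞 y implies f(x) ⪯_𝒞 f(y)) and multi-homogeneous with homogeneity matrix B, i.e. B_{ij} ≥ 0 and f(x_1, …, λx_j, …, x_ν)_i = λ^{B_{ij}} f(x_1, …, x_ν)_i for every λ ≥ 0 and all i, j. Then B is a Lipschitz matrix for f with respect to the Hilbert metrics: for all x, y ∈ 𝒞 with x_j ∼_{C_j} y_j for every j, d_{C_i}(f(x)_i, f(y)_i) ≤ Σ_{j=1}^ν B_{ij} · d_{C_j}(x_j, y_j) for every i = 1, …, ν. -/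
section helpers
variable {V : Type*} [AddCommGroup V] [Module ℝ V] {C : Set V}

theorem IsCone.smulMem (h : IsCone C) {x : V} (hx : x ∈ C) {a : ℝ} (ha : 0 ≤ a) : a • x ∈ C :=
  h.2.1 x hx a ha

theorem IsCone.addMem (h : IsCone C) {x y : V} (hx : x ∈ C) (hy : y ∈ C) : x + y ∈ C := by
  have h1 : (1/2 : ℝ) • x + (1/2 : ℝ) • y ∈ C :=
    h.1 hx hy (by norm_num) (by norm_num) (by norm_num)
  have h2 := h.smulMem h1 (a := 2) (by norm_num)
  convert h2 using 1
  rw [smul_add, smul_smul, smul_smul]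
  norm_num

theorem IsCone.eqZero (h : IsCone C) {x : V} (hx : x ∈ C) (hy : -x ∈ C) : x = 0 := by
  have : x ∈ C ∩ (-C) := ⟨hx, by simpa using hy⟩
  rw [h.2.2] at this
  simpa using this

theorem IsCone.zeroMem (h : IsCone C) : (0 : V) ∈ C := by
  have : (0 : V) ∈ C ∩ (-C) := by rw [h.2.2]; rfl
  exact this.1

theorem IsCone.nonneg_of_smul (h : IsCone C) {x : V} (hx : x ∈ C) (h0 : x ≠ 0) {a : ℝ}
    (ha : a • x ∈ C) : 0 ≤ a := by
  by_contra! hn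
  apply h0
  apply h.eqZero hx
  have := h.smulMem ha (a := (-a)⁻¹) (by rw [inv_nonneg]; linarith)
  convert this using 1
  rw [smul_smul, inv_neg, neg_mul, inv_mul_cancel₀ hn.ne, neg_smul, one_smul]

theorem coneLE.tr (h : IsCone C) {x y z : V} (h1 : coneLE C x y) (h2 : coneLE C y z) :
    coneLE C x z := by
  have := h.addMem h1 h2
  unfold coneLE
  convert this using 1
  abel

theorem coneLE.smul' (h : IsCone C) {x y : V} (h1 : coneLE C x y) {a : ℝ} (ha : 0 ≤ a) :
    coneLE C (a • x) (a • y) := by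
  have := h.smulMem h1 ha
  unfold coneLE
  rwa [← smul_sub]

theorem coneLE.smul_mono (h : IsCone C) {x y : V} (hy : y ∈ C) {a b : ℝ} (hab : a ≤ b)
    (h1 : coneLE C x (a • y)) : coneLE C x (b • y) := by
  refine h1.tr h ?_
  unfold coneLE
  rw [← sub_smul]
  exact h.smulMem hy (by linarith)

theorem coneLE.inv' (h : IsCone C) {x y : V} {a : ℝ} (ha : 0 < a)
    (h1 : coneLE C x (a • y)) : coneLE C (a⁻¹ • x) y := by
  have := h1.smul' h (inv_nonneg.2 ha.le)
  rwa [smul_smul, inv_mul_cancel₀ ha.ne', one_smul] at this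

theorem cone_lower (h : IsCone C) {x y : V} (hy : y ∈ C) (h0 : y ≠ 0) {a b : ℝ}
    (h1 : coneLE C (a • y) x) (h2 : coneLE C x (b • y)) : a ≤ b := by
  have := h1.tr h h2
  unfold coneLE at this
  rw [← sub_smul] at this
  linarith [h.nonneg_of_smul hy h0 this]

theorem coneM_zero (h : IsCone C) : coneM C (0 : V) 0 = 0 := by
  have : {β : ℝ | coneLE C (0 : V) (β • (0 : V))} = Set.univ := by
    ext β; simp [coneLE, h.zeroMem]
  rw [coneM, this, Real.sInf_univ]

theorem hilbertD_zero (h : IsCone C) : hilbertD C (0 : V) 0 = 0 := by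
  simp [hilbertD, coneM_zero h]

/-- data on `coneM` for nonzero comparable vectors -/
theorem coneM_facts (h : IsCone C) {x y : V} (hy : y ∈ C) (h0 : y ≠ 0)
    {a b : ℝ} (ha : 0 < a) (h1 : coneLE C (a • y) x) (h2 : coneLE C x (b • y)) :
    0 < coneM C x y ∧ (∀ c, coneLE C x (c • y) → coneM C x y ≤ c) ∧
      (∀ c, coneM C x y < c → coneLE C x (c • y)) := by
  have hb : BddBelow {β : ℝ | coneLE C x (β • y)} := ⟨a, fun c hc => cone_lower h hy h0 h1 hc⟩
  have hne : {β : ℝ | coneLE C x (β • y)}.Nonempty := ⟨b, h2⟩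
  refine ⟨lt_of_lt_of_le ha (le_csInf hne fun c hc => cone_lower h hy h0 h1 hc),
    fun c hc => csInf_le hb hc, fun c hc => ?_⟩
  obtain ⟨d, hd, hdc⟩ := exists_lt_of_csInf_lt hne hc
  exact coneLE.smul_mono h hy hdc.le hd

theorem hilbert_extract (h : IsCone C) {x y : V} (hx : x ∈ C) (hy : y ∈ C)
    (hc : coneComp C x y) : ∃ a a' : ℝ, hilbertD C x y = a + a' ∧ 0 ≤ a + a' ∧
      (∀ s > 0, coneLE C x (Real.exp (s + a) • y)) ∧
      (∀ s > 0, coneLE C y (Real.exp (s + a') • x)) := by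
  obtain ⟨⟨α, hα, h1⟩, β, hβ, h2⟩ := hc
  have h1' : coneLE C y (α⁻¹ • x) := by
    have := h1.smul' h (inv_nonneg.2 hα.le)
    rwa [smul_smul, inv_mul_cancel₀ hα.ne', one_smul] at this
  have h2' := h2.inv' h hβ
  by_cases hy0 : y = 0
  · subst hy0
    have hx0 : x = 0 := h.eqZero hx (by simpa [coneLE] using h2)
    subst hx0
    refine ⟨0, 0, by simp [hilbertD_zero h], by simp, ?_, ?_⟩ <;>
    · intro s _; simp [coneLE, h.zeroMem]
  have hx0 : x ≠ 0 := by
    rintro rfl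
    exact hy0 (h.eqZero hy (by simpa [coneLE] using h1'))
  obtain ⟨p, -, e⟩ := coneM_facts h hy hy0 hα h1 h2
  obtain ⟨p', -, e'⟩ := coneM_facts h hx hx0 (inv_pos.2 hβ) h2' h1'
  have k : ∀ s > 0, coneLE C x (Real.exp (s + Real.log (coneM C x y)) • y) := by
    intro s hs
    apply e
    rw [Real.exp_add, Real.exp_log p]
    exact lt_mul_of_one_lt_left p (Real.one_lt_exp_iff.2 hs)
  have k' : ∀ s > 0, coneLE C y (Real.exp (s + Real.log (coneM C y x)) • x) := by
    intro s hs
    apply e'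
    rw [Real.exp_add, Real.exp_log p']
    exact lt_mul_of_one_lt_left p' (Real.one_lt_exp_iff.2 hs)
  refine ⟨_, _, Real.log_mul p.ne' p'.ne', ?_, k, k'⟩
  refine le_of_forall_pos_le_add fun s hs => ?_
  have q := k (s/2) (by linarith)
  have q' := (k' (s/2) (by linarith)).smul' h
    (Real.exp_pos (s/2 + Real.log (coneM C x y))).le
  have q2 := q.tr h q'
  rw [smul_smul, ← Real.exp_add] at q2
  have q3 := cone_lower h hx hx0 (a := 1) (x := x) (by simp [coneLE, h.zeroMem]) q2
  have := Real.one_le_exp_iff.1 q3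
  linarith

theorem hilbert_bound (h : IsCone C) {x y : V} (hx : x ∈ C) (hy : y ∈ C) {a a' K : ℝ}
    (hK : 0 ≤ K) (haa : 0 ≤ a + a')
    (h1 : ∀ s > 0, coneLE C x (Real.exp (s * K + a) • y))
    (h2 : ∀ s > 0, coneLE C y (Real.exp (s * K + a') • x)) : hilbertD C x y ≤ a + a' := by
  by_cases hy0 : y = 0
  · subst hy0
    have hx0 : x = 0 := h.eqZero hx (by simpa [coneLE] using h1 1 one_pos)
    subst hx0
    rwa [hilbertD_zero h]
  have hx0 : x ≠ 0 := by
    rintro rfl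
    exact hy0 (h.eqZero hy (by simpa [coneLE] using h2 1 one_pos))
  have u := h1 1 one_pos
  have u' := h2 1 one_pos
  obtain ⟨p, l, -⟩ := coneM_facts h hy hy0 (inv_pos.2 (Real.exp_pos _))
    (u'.inv' h (Real.exp_pos _)) u
  obtain ⟨p', l', -⟩ := coneM_facts h hx hx0 (inv_pos.2 (Real.exp_pos _))
    (u.inv' h (Real.exp_pos _)) u'
  rw [hilbertD, Real.log_mul p.ne' p'.ne']
  have g : ∀ s > 0, Real.log (coneM C x y) + Real.log (coneM C y x) ≤ a + a' + s * (2 * K) := by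
    intro s hs
    have := (Real.log_le_iff_le_exp p).2 (l _ (h1 s hs))
    have := (Real.log_le_iff_le_exp p').2 (l' _ (h2 s hs))
    linarith
  refine le_of_forall_pos_le_add fun e he => (g (e / (2 * K + 1)) (by positivity)).trans ?_
  have : e / (2 * K + 1) * (2 * K) ≤ e := by
    rw [div_mul_eq_mul_div, div_le_iff₀ (by positivity)]
    nlinarith
  linarith

end helpers

theorem hom_all
    {ι : Type*} [Fintype ι] [DecidableEq ι] {V : ι → Type*}
    [∀ i, AddCommGroup (V i)] [∀ i, Module ℝ (V i)]
    (C : ∀ i, Set (V i)) (hC : ∀ i, IsCone (C i))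
    (f : (∀ i, V i) → (∀ i, V i))
    (B : Matrix ι ι ℝ)
    (hhom : ∀ x : ∀ i, V i, (∀ j, x j ∈ C j) → ∀ l : ℝ, 0 ≤ l → ∀ i j,
      f (Function.update x j (l • x j)) i = Real.rpow l (B i j) • f x i)
    (x : ∀ i, V i) (hx : ∀ j, x j ∈ C j) (a : ι → ℝ) (i : ι) :
    f (fun j => Real.exp (a j) • x j) i = Real.exp (∑ j, B i j * a j) • f x i := by
  have key : ∀ S : Finset ι, f (fun j => if j ∈ S then Real.exp (a j) • x j else x j) i
      = Real.exp (∑ j ∈ S, B i j * a j) • f x i := by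
    intro S
    induction S using Finset.induction_on with
    | empty => simp
    | insert k S hk ih =>
      have hm : ∀ j, (fun j => if j ∈ S then Real.exp (a j) • x j else x j) j ∈ C j := by
        intro j
        dsimp only
        split_ifs
        · exact (hC j).smulMem (hx j) (Real.exp_pos _).le
        · exact hx j
      have := hhom _ hm (Real.exp (a k)) (Real.exp_pos _).le i k
      rw [ih] at this
      rw [Finset.sum_insert hk, Real.exp_add, mul_smul]
      convert this using 2
      · ext j
        by_cases hj : j = k
        · subst hj; simp [hk]
        · simp [hj]
      · rw [Real.rpow_eq_pow, ← Real.exp_mul, mul_comm]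
  simpa using key Finset.univ

/-- **Homogeneity matrix is a Lipschitz matrix**: an order-preserving multi-homogeneous
self-map of a product of cones with homogeneity matrix `B` satisfies
`d_{C_i}(f(x)_i, f(y)_i) ≤ Σ_j B_{ij} d_{C_j}(x_j, y_j)`. -/
theorem homogeneity_matrix_is_lipschitz
    {ι : Type*} [Fintype ι] [DecidableEq ι] {V : ι → Type*}
    [∀ i, AddCommGroup (V i)] [∀ i, Module ℝ (V i)]
    (C : ∀ i, Set (V i)) (hC : ∀ i, IsCone (C i))
    (f : (∀ i, V i) → (∀ i, V i))
    (hf : ∀ x : ∀ i, V i, (∀ j, x j ∈ C j) → ∀ i, f x i ∈ C i)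
    (hmono : ∀ x y : ∀ i, V i, (∀ j, x j ∈ C j) → (∀ j, y j ∈ C j) →
      (∀ j, coneLE (C j) (x j) (y j)) → ∀ i, coneLE (C i) (f x i) (f y i))
    (B : Matrix ι ι ℝ) (hB : ∀ i j, 0 ≤ B i j)
    (hhom : ∀ x : ∀ i, V i, (∀ j, x j ∈ C j) → ∀ l : ℝ, 0 ≤ l → ∀ i j,
      f (Function.update x j (l • x j)) i = Real.rpow l (B i j) • f x i) :
    ∀ x y : ∀ i, V i, (∀ j, x j ∈ C j) → (∀ j, y j ∈ C j) →
      (∀ j, coneComp (C j) (x j) (y j)) →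
      ∀ i, hilbertD (C i) (f x i) (f y i) ≤ ∑ j, B i j * hilbertD (C j) (x j) (y j) := by
  intro x y hx hy hc i
  choose a a' hd h0 h1 h2 using fun j => hilbert_extract (hC j) (hx j) (hy j) (hc j)
  have main : ∀ (u v : ∀ i, V i) (b : ι → ℝ), (∀ j, u j ∈ C j) → (∀ j, v j ∈ C j) →
      (∀ j, ∀ s > 0, coneLE (C j) (u j) (Real.exp (s + b j) • v j)) →
      ∀ s > 0, coneLE (C i) (f u i)
        (Real.exp (s * (∑ j, B i j) + ∑ j, B i j * b j) • f v i) := by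
    intro u v b hu hv hb s hs
    have := hmono u (fun j => Real.exp (s + b j) • v j) hu
      (fun j => (hC j).smulMem (hv j) (Real.exp_pos _).le) (fun j => hb j s hs) i
    rw [hom_all C hC f B hhom v hv (fun j => s + b j) i] at this
    convert this using 3
    rw [Finset.mul_sum, ← Finset.sum_add_distrib]
    exact Finset.sum_congr rfl fun j _ => by ring
  have e : ∑ j, B i j * hilbertD (C j) (x j) (y j)
      = (∑ j, B i j * a j) + ∑ j, B i j * a' j := by
    rw [← Finset.sum_add_distrib]
    exact Finset.sum_congr rfl fun j _ => by rw [hd j]; ring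
  have e0 : 0 ≤ ∑ j, B i j * hilbertD (C j) (x j) (y j) :=
    Finset.sum_nonneg fun j _ => mul_nonneg (hB i j) (by rw [hd j]; exact h0 j)
  rw [e] at e0 ⊢
  exact hilbert_bound (hC i) (hf x hx i) (hf y hy i)
    (Finset.sum_nonneg fun j _ => hB i j) e0 (main x y a hx hy h1) (main y x a' hy hx h2)
end
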